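/- Let K be a compact topological group and let the product topological group G = ℝ × K act continuously on a metric space Y by isometries (for each g ∈ G the map x ↦ g•x is an isometry of Y, and the action map G × Y → Y is continuous). Let y ∈ Y and assume: (i) (0,k)•y = y for every k ∈ K; (ii) for every R ≥ 0 the set {t ∈ ℝ : dist((t,1)•y, y) ≤ R} is bounded. Let S ⊆ G be a closed symmetric subset (1 ∈ S and s⁻¹ ∈ S whenever s ∈ S) such that the orbit set S•y = {s•y : s ∈ S} satisfies: (1) S•y is closed under multiplication, i.e., for all s₁, s₂ ∈ S there exists s ∈ S with (s₁·s₂)•y = s•y; and (2) S•y is a bounded subset of Y. Then S•y = {y}. -/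

import Mathlib

/-- Let `G = ℝ × K` (with `K` compact) act continuously and isometrically
on a metric space `Y`. Suppose `K` fixes `y`, the orbit of `y` under the `ℝ`-factor is
metrically proper, and `S ⊆ G` is a closed symmetric subset whose orbit set `S•y` is
bounded and closed under multiplication. Then `S•y = {y}`. -/
theorem stmt1 {Y K : Type*} [MetricSpace Y]
    [Group K] [TopologicalSpace K] [IsTopologicalGroup K] [CompactSpace K]
    [MulAction (Multiplicative ℝ × K) Y]
    (hiso : ∀ g : Multiplicative ℝ × K, Isometry (fun x : Y => g • x))
    (hcont : Continuous (fun p : (Multiplicative ℝ × K) × Y => p.1 • p.2))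
    (y : Y)
    (hfix : ∀ k : K,
      ((Multiplicative.ofAdd (0 : ℝ), k) : Multiplicative ℝ × K) • y = y)
    (hproper : ∀ R : ℝ, 0 ≤ R → Bornology.IsBounded
      {t : ℝ | dist (((Multiplicative.ofAdd t, (1 : K)) : Multiplicative ℝ × K) • y) y ≤ R})
    (S : Set (Multiplicative ℝ × K))
    (hSclosed : IsClosed S)
    (hSone : (1 : Multiplicative ℝ × K) ∈ S)
    (hSinv : ∀ s ∈ S, s⁻¹ ∈ S)
    (hmul : ∀ s₁ ∈ S, ∀ s₂ ∈ S, ∃ s ∈ S, (s₁ * s₂) • y = s • y)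
    (hbdd : Bornology.IsBounded ((fun s : Multiplicative ℝ × K => s • y) '' S)) :
    (fun s : Multiplicative ℝ × K => s • y) '' S = {y} := by
  have hk : ∀ (t : ℝ) (k : K), ((Multiplicative.ofAdd t, k) : Multiplicative ℝ × K) • y
      = ((Multiplicative.ofAdd t, (1 : K)) : Multiplicative ℝ × K) • y := by
    intro t k
    have h : ((Multiplicative.ofAdd t, k) : Multiplicative ℝ × K)
        = (Multiplicative.ofAdd t, (1 : K)) * (Multiplicative.ofAdd (0 : ℝ), k) := by
      simp
    rw [h, mul_smul, hfix]
  obtain ⟨R, hR⟩ := hbdd.subset_closedBall y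
  have hR0 : 0 ≤ R := by
    have := hR ⟨1, hSone, rfl⟩
    exact dist_nonneg.trans (Metric.mem_closedBall.1 this)
  apply Set.eq_singleton_iff_unique_mem.2
  refine ⟨⟨1, hSone, one_smul _ y⟩, ?_⟩
  rintro _ ⟨⟨t', k⟩, hs, rfl⟩
  obtain ⟨t, rfl⟩ := Multiplicative.ofAdd.surjective t'
  have hn : ∀ n : ℕ, ∃ s ∈ S,
      s • y = ((Multiplicative.ofAdd ((n : ℝ) * t), (1 : K)) : Multiplicative ℝ × K) • y := by
    intro n
    induction n with
    | zero => exact ⟨1, hSone, by rw [one_smul]; simpa using (hfix 1).symm⟩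
    | succ n ih =>
      obtain ⟨s, hsS, hsy⟩ := ih
      obtain ⟨r, hrS, hr⟩ := hmul _ hs _ hsS
      refine ⟨r, hrS, ?_⟩
      rw [← hr, mul_smul, hsy, ← mul_smul, Prod.mk_mul_mk, ← ofAdd_add, hk]
      congr 3
      push_cast
      ring_nf
  obtain ⟨C, hC⟩ := (hproper R hR0).exists_norm_le
  have hb : ∀ n : ℕ, (n : ℝ) * |t| ≤ C := by
    intro n
    obtain ⟨s, hsS, hsy⟩ := hn n
    have h1 := Metric.mem_closedBall.1 (hR ⟨s, hsS, rfl⟩)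
    simp only [hsy] at h1
    have h2 := hC _ h1
    rwa [Real.norm_eq_abs, abs_mul, Nat.abs_cast] at h2
  have ht : t = 0 := by
    by_contra hne
    obtain ⟨n, hn'⟩ := exists_nat_gt (C / |t|)
    rw [div_lt_iff₀ (abs_pos.2 hne)] at hn'
    exact absurd (hb n) (not_le.2 hn')
  subst ht
  exact hfix k
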